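/- For each T > 0 there exist positive constants δ, C_1, C_2 such that −C_2|t − s|^{-1/2} Δt ≤ ρ(s, t+Δt) − ρ(s, t) ≤ −C_1|t + Δt − s|^{-1/2} Δt for all 0 ≤ s < t ≤ T and Δt > 0 with |t − s| < δ and Δt < δ. (The middle quantity equals E[F(s)(F(t+Δt) − F(t))] for any centered Gaussian process F with covariance ρ.) -/

import Mathlib

open MeasureTheory Real Set Filter

/-- The Gaussian heat kernel `p(t,x,y) = (2πt)^{-1/2} exp(-(x-y)²/(2t))`. -/
noncomputable def heatKernel (t x y : ℝ) : ℝ :=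
  (Real.sqrt (2 * Real.pi * t))⁻¹ * Real.exp (-(x - y) ^ 2 / (2 * t))

/-- The density `u(x,t)` of `B(t)`: `f` evolved by the heat semigroup. -/
noncomputable def udens (f : ℝ → ℝ) (x t : ℝ) : ℝ :=
  if t = 0 then f x else ∫ y : ℝ, heatKernel t x y * f y

/-- The covariance function
`ρ(s,t) = (P(B(s) ≤ q(s), B(t) ≤ q(t)) − α²)/(u(q(s),s) u(q(t),t))`. -/
noncomputable def rho {Ω : Type*} [MeasurableSpace Ω] (P : Measure Ω)
    (B : ℝ → Ω → ℝ) (f : ℝ → ℝ) (q : ℝ → ℝ) (α s t : ℝ) : ℝ :=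
  ((P {ω | B s ω ≤ q s ∧ B t ω ≤ q t}).toReal - α ^ 2) /
    (udens f (q s) s * udens f (q t) t)


open ProbabilityTheory Topology MeasureTheory.Measure
open scoped NNReal

/-- The mean of `g` under a Gaussian law with mean `x` and variance `v`. -/
noncomputable def gaussAvg (g : ℝ → ℝ) (x : ℝ) (v : ℝ≥0) : ℝ :=
  ∫ z, g (x + z) ∂gaussianReal 0 v

lemma integrable_gaussianReal_of_bounded {g : ℝ → ℝ} {C : ℝ} (hg : Continuous g)
    (hC : ∀ x, |g x| ≤ C) (m : ℝ) (v : ℝ≥0) : Integrable g (gaussianReal m v) :=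
  Integrable.of_bound hg.aestronglyMeasurable C (Eventually.of_forall hC)

lemma abs_gaussAvg_le {g : ℝ → ℝ} {C : ℝ} (hC : ∀ x, |g x| ≤ C) (x : ℝ) (v : ℝ≥0) :
    |gaussAvg g x v| ≤ C := by
  have h := norm_integral_le_of_norm_le_const (μ := gaussianReal 0 v)
    (f := fun z => g (x + z)) (C := C) (Eventually.of_forall fun z => hC (x + z))
  simpa [gaussAvg] using h

lemma hasDerivAt_gaussAvg {g g' : ℝ → ℝ} {C C' : ℝ} (hg : ∀ x, HasDerivAt g (g' x) x)
    (hg' : Continuous g') (hC : ∀ x, |g x| ≤ C) (hC' : ∀ x, |g' x| ≤ C') (v : ℝ≥0) (x : ℝ) :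
    HasDerivAt (fun x => gaussAvg g x v) (gaussAvg g' x v) x := by
  have hgc : Continuous g := continuous_iff_continuousAt.2 fun x => (hg x).continuousAt
  refine (hasDerivAt_integral_of_dominated_loc_of_deriv_le (μ := gaussianReal 0 v)
    (F := fun x z => g (x + z)) (F' := fun x z => g' (x + z)) (bound := fun _ => C')
    (s := univ) univ_mem ?_ ?_ ?_ ?_ ?_ ?_).2
  · exact Eventually.of_forall fun y =>
      (hgc.comp (continuous_const.add continuous_id)).aestronglyMeasurable
  · exact integrable_gaussianReal_of_bounded (hgc.comp (continuous_const.add continuous_id))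
      (fun z => hC (x + z)) 0 v
  · exact (hg'.comp (continuous_const.add continuous_id)).aestronglyMeasurable
  · exact Eventually.of_forall fun z y _ => hC' (y + z)
  · exact integrable_const _
  · exact Eventually.of_forall fun z y _ => (hg (y + z)).comp_add_const y z

lemma abs_sub_le_of_hasDerivAt {g g' : ℝ → ℝ} {C : ℝ} (hg : ∀ x, HasDerivAt g (g' x) x)
    (hC : ∀ x, |g' x| ≤ C) (x y : ℝ) : |g y - g x| ≤ C * |y - x| := by
  simpa using Convex.norm_image_sub_le_of_norm_hasDerivWithin_le
    (f := g) (f' := g') (s := univ) (x := x) (y := y) (fun x _ => (hg x).hasDerivWithinAt)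
    (fun x _ => hC x) convex_univ (mem_univ _) (mem_univ _)

lemma abs_taylor_one_le {g g' g'' : ℝ → ℝ} {K : ℝ} (hg : ∀ x, HasDerivAt g (g' x) x)
    (hg' : ∀ x, HasDerivAt g' (g'' x) x) (hK : ∀ x, |g'' x| ≤ K) (y w : ℝ) :
    |g (y + w) - g y - g' y * w| ≤ K * w ^ 2 := by
  have hd : ∀ x, HasDerivAt (fun x => g (y + x) - g' y * x) (g' (y + x) - g' y) x := fun x => by
    simpa [Pi.sub_def] using ((hg (y + x)).comp_const_add y x).sub ((hasDerivAt_id x).const_mul (g' y))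
  have h := Convex.norm_image_sub_le_of_norm_hasDerivWithin_le
    (f := fun x => g (y + x) - g' y * x) (f' := fun x => g' (y + x) - g' y)
    (s := uIcc 0 w) (x := 0) (y := w) (C := K * |w|)
    (fun x _ => (hd x).hasDerivWithinAt) (fun x hx => ?_) (convex_uIcc 0 w)
    left_mem_uIcc right_mem_uIcc
  · simp only [Real.norm_eq_abs, add_zero, mul_zero, sub_zero] at h
    rw [mul_assoc, ← sq, sq_abs] at h
    rwa [show g (y + w) - g y - g' y * w = g (y + w) - g' y * w - g y by ring]
  · have h0 : 0 ≤ K := (abs_nonneg _).trans (hK 0)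
    have h1 := abs_sub_le_of_hasDerivAt hg' hK y (y + x)
    have h2 : |x| ≤ |w| := by simpa using abs_sub_left_of_mem_uIcc hx
    rw [add_sub_cancel_left] at h1
    exact h1.trans (mul_le_mul_of_nonneg_left h2 h0)

lemma integral_sq_gaussianReal_zero (v : ℝ≥0) : ∫ z, z ^ 2 ∂gaussianReal 0 v = v := by
  have h := variance_fun_id_gaussianReal (μ := 0) (v := v)
  rwa [variance_of_integral_eq_zero measurable_id'.aemeasurable
    (by simp)] at h

lemma abs_gaussAvg_sub_self_le {g g' g'' : ℝ → ℝ} {C K : ℝ}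
    (hg : ∀ x, HasDerivAt g (g' x) x) (hg' : ∀ x, HasDerivAt g' (g'' x) x)
    (hC : ∀ x, |g x| ≤ C) (hK : ∀ x, |g'' x| ≤ K) (y : ℝ) (v : ℝ≥0) :
    |gaussAvg g y v - g y| ≤ K * v := by
  have hgc : Continuous g := continuous_iff_continuousAt.2 fun x => (hg x).continuousAt
  have hid : Integrable (fun z : ℝ => z) (gaussianReal 0 v) :=
    (memLp_id_gaussianReal 1).integrable (by norm_num)
  have hsq : Integrable (fun z : ℝ => z ^ 2) (gaussianReal 0 v) :=
    (memLp_id_gaussianReal (μ := 0) (v := v) 2).integrable_sq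
  have hi : Integrable (fun z => g (y + z)) (gaussianReal 0 v) :=
    integrable_gaussianReal_of_bounded (hgc.comp (continuous_const.add continuous_id))
      (fun z => hC (y + z)) 0 v
  have heq : gaussAvg g y v - g y
      = ∫ z, (g (y + z) - g y - g' y * z) ∂gaussianReal 0 v := by
    rw [integral_sub (f := fun z => g (y + z) - g y) (hi.sub (integrable_const _))
      (hid.const_mul _), integral_sub hi (integrable_const _), integral_const_mul, integral_id_gaussianReal]
    simp [gaussAvg]
  rw [heq, ← Real.norm_eq_abs]
  calc _ ≤ ∫ z, K * z ^ 2 ∂gaussianReal 0 v :=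
        norm_integral_le_of_norm_le (hsq.const_mul K)
          (Eventually.of_forall fun z => abs_taylor_one_le hg hg' hK y z)
    _ = K * v := by rw [integral_const_mul, integral_sq_gaussianReal_zero]

lemma abs_gaussAvg_sub_le {g g' g'' : ℝ → ℝ} {C K : ℝ}
    (hg : ∀ x, HasDerivAt g (g' x) x) (hg' : ∀ x, HasDerivAt g' (g'' x) x)
    (hC : ∀ x, |g x| ≤ C) (hK : ∀ x, |g'' x| ≤ K) (x : ℝ) {s t : ℝ} (hs : 0 ≤ s) (ht : 0 ≤ t) :
    |gaussAvg g x t.toNNReal - gaussAvg g x s.toNNReal| ≤ K * |t - s| := by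
  wlog hst : s ≤ t generalizing s t
  · rw [abs_sub_comm, abs_sub_comm t]
    exact this ht hs (le_of_not_ge hst)
  have hgc : Continuous g := continuous_iff_continuousAt.2 fun x => (hg x).continuousAt
  have hi : ∀ y v, Integrable (fun z => g (y + z)) (gaussianReal 0 v) := fun y v =>
    integrable_gaussianReal_of_bounded (hgc.comp (continuous_const.add continuous_id))
      (fun z => hC (y + z)) 0 v
  set d : ℝ≥0 := (t - s).toNNReal
  have htd : t.toNNReal = s.toNNReal + d := by
    rw [← Real.toNNReal_add hs (sub_nonneg.2 hst)]; congr 1; ring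
  have hconv : gaussianReal 0 (s.toNNReal + d) = gaussianReal 0 s.toNNReal ∗ gaussianReal 0 d := by
    rw [gaussianReal_conv_gaussianReal, add_zero]
  have hcont : Continuous fun y => gaussAvg g (x + y) d :=
    continuous_of_dominated (bound := fun _ => C)
      (fun y => (hgc.comp (continuous_const.add continuous_id)).aestronglyMeasurable)
      (fun y => Eventually.of_forall fun z => hC _) (integrable_const _)
      (Eventually.of_forall fun z => hgc.comp (by fun_prop))
  have hi2 : Integrable (fun y => gaussAvg g (x + y) d) (gaussianReal 0 s.toNNReal) :=
    integrable_gaussianReal_of_bounded hcont (fun y => abs_gaussAvg_le hC (x + y) d) 0 _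
  have heq : gaussAvg g x t.toNNReal = ∫ y, gaussAvg g (x + y) d ∂gaussianReal 0 s.toNNReal := by
    rw [gaussAvg, htd, hconv, integral_conv (by rw [← hconv]; exact hi x _)]
    simp only [gaussAvg, add_assoc]
  rw [heq, gaussAvg, ← integral_sub hi2 (hi x _), abs_of_nonneg (sub_nonneg.2 hst)]
  have h := norm_integral_le_of_norm_le_const (μ := gaussianReal 0 s.toNNReal)
    (f := fun y => gaussAvg g (x + y) d - g (x + y)) (C := K * d)
    (Eventually.of_forall fun y => abs_gaussAvg_sub_self_le hg hg' hC hK (x + y) d)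
  simpa [d, Real.coe_toNNReal _ (sub_nonneg.2 hst)] using h

lemma heatKernel_eq_gaussianPDFReal {t : ℝ} (ht : 0 ≤ t) (x y : ℝ) :
    heatKernel t x y = gaussianPDFReal x t.toNNReal y := by
  rw [heatKernel, gaussianPDFReal, Real.coe_toNNReal _ ht, show (x - y) ^ 2 = (y - x) ^ 2 by ring]

lemma heatKernel_comm (t x y : ℝ) : heatKernel t x y = heatKernel t y x := by
  rw [heatKernel, heatKernel, show (x - y) ^ 2 = (y - x) ^ 2 by ring]

lemma udens_eq_gaussAvg (f : ℝ → ℝ) (x : ℝ) {t : ℝ} (ht : 0 ≤ t) :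
    udens f x t = gaussAvg f x t.toNNReal := by
  rcases ht.eq_or_lt with rfl | ht'
  · simp [udens, gaussAvg, gaussianReal_zero_var]
  · rw [udens, if_neg ht'.ne', gaussAvg,
      ← (measurableEmbedding_addLeft x).integral_map (μ := gaussianReal 0 t.toNNReal),
      gaussianReal_map_const_add, zero_add,
      integral_gaussianReal_eq_integral_smul (by simpa using ht')]
    simp [heatKernel_eq_gaussianPDFReal ht]

lemma integrable_gaussAvg_prod {f : ℝ → ℝ} (hfc : Continuous f) (hf : Integrable f) (v : ℝ≥0) :
    Integrable (fun p : ℝ × ℝ => f (p.1 + p.2)) (volume.prod (gaussianReal 0 v)) := by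
  have hm : AEStronglyMeasurable (fun p : ℝ × ℝ => f (p.1 + p.2))
      (volume.prod (gaussianReal 0 v)) :=
    (hfc.comp (continuous_fst.add continuous_snd)).aestronglyMeasurable
  rw [integrable_prod_iff' hm]
  refine ⟨Eventually.of_forall fun z => hf.comp_add_right z, ?_⟩
  simp only [integral_add_right_eq_self (fun x => ‖f x‖)]
  exact integrable_const _

lemma integrable_gaussAvg {f : ℝ → ℝ} (hfc : Continuous f) (hf : Integrable f) (v : ℝ≥0) :
    Integrable (fun x => gaussAvg f x v) :=
  (integrable_gaussAvg_prod hfc hf v).integral_prod_left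

lemma setIntegral_Iic_gaussAvg {f : ℝ → ℝ} (hfc : Continuous f) (hf : Integrable f) (v : ℝ≥0) (r : ℝ) :
    ∫ x in Iic r, gaussAvg f x v = gaussAvg (fun a => ∫ x in Iic a, f x) r v := by
  simp only [gaussAvg]
  rw [integral_integral_swap]
  · congr 1 with z
    have h := (measurePreserving_add_right volume z).setIntegral_preimage_emb
      (measurableEmbedding_addRight z) f (Iic (r + z))
    simpa using h
  · have h := (integrable_gaussAvg_prod hfc hf v).integrableOn (s := Iic r ×ˢ univ)
    rwa [IntegrableOn, ← Measure.prod_restrict, Measure.restrict_univ] at h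

lemma hasDerivAt_setIntegral_Iic {f : ℝ → ℝ} (hfc : Continuous f) (hf : Integrable f) (c : ℝ) :
    HasDerivAt (fun c => ∫ x in Iic c, f x) (f c) c := by
  have h : (fun c => ∫ x in Iic c, f x) = fun c => (∫ x in Iic 0, f x) + ∫ x in (0 : ℝ)..c, f x := by
    ext c
    rw [← intervalIntegral.integral_Iic_sub_Iic hf.integrableOn hf.integrableOn]
    ring
  rw [h]
  exact (intervalIntegral.integral_hasDerivAt_right (hfc.intervalIntegrable _ _)
    hfc.stronglyMeasurable.stronglyMeasurableAtFilter hfc.continuousAt).const_add _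

lemma continuous_gaussianPDFReal (m : ℝ) (v : ℝ≥0) : Continuous (gaussianPDFReal m v) := by
  unfold gaussianPDFReal; fun_prop

lemma setIntegral_Iic_heatKernel {h : ℝ} (hh : 0 < h) (x b : ℝ) :
    ∫ y in Iic b, heatKernel h x y = ∫ z in Iic ((b - x) / √h), gaussianPDFReal 0 1 z := by
  have hs : 0 < √h := Real.sqrt_pos.2 hh
  have hmap : gaussianReal x h.toNNReal = (gaussianReal 0 1).map (fun z => x + √h * z) := by
    have h1 : (gaussianReal 0 1).map (fun z => √h * z) = gaussianReal 0 h.toNNReal := by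
      rw [gaussianReal_map_const_mul, mul_zero, mul_one]
      congr 1
      ext
      simp [Real.sq_sqrt hh.le, hh.le]
    have h2 : (fun z => x + √h * z) = (fun z => x + z) ∘ fun z => √h * z := rfl
    rw [h2, ← Measure.map_map (by fun_prop) (by fun_prop), h1, gaussianReal_map_const_add, zero_add]
  have hpre : (fun z => x + √h * z) ⁻¹' Iic b = Iic ((b - x) / √h) := by
    ext z
    simp only [mem_preimage, mem_Iic]
    rw [le_div_iff₀ hs]
    constructor <;> intro <;> linarith
  have hv : h.toNNReal ≠ 0 := by simpa using hh
  have h3 := gaussianReal_apply_eq_integral x hv (Iic b)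
  rw [hmap, Measure.map_apply (by fun_prop) measurableSet_Iic, hpre,
    gaussianReal_apply_eq_integral 0 one_ne_zero, ENNReal.ofReal_eq_ofReal_iff
      (setIntegral_nonneg measurableSet_Iic fun z _ => gaussianPDFReal_nonneg _ _ z)
      (setIntegral_nonneg measurableSet_Iic fun z _ => gaussianPDFReal_nonneg _ _ z)] at h3
  rw [h3]
  simp only [heatKernel_eq_gaussianPDFReal hh.le]

lemma heatKernel_eq_inv_sqrt_mul {h : ℝ} (hh : 0 < h) (x b : ℝ) :
    heatKernel h x b = (√h)⁻¹ * gaussianPDFReal 0 1 ((b - x) / √h) := by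
  have h1 : ((b - x) / √h) ^ 2 = (x - b) ^ 2 / h := by
    rw [div_pow, Real.sq_sqrt hh.le]; ring
  rw [heatKernel, gaussianPDFReal, sub_zero, h1, Real.sqrt_mul (by positivity)]
  simp only [NNReal.coe_one, mul_one, mul_inv]
  rw [show -((x - b) ^ 2 / h) / 2 = -(x - b) ^ 2 / (2 * h) by field_simp]
  ring

lemma gaussianPDFReal_zero_one_le (z : ℝ) : gaussianPDFReal 0 1 z ≤ Real.exp (-(z ^ 2 / 2)) := by
  have h1 : (1 : ℝ) ≤ √(2 * π * 1) := by
    rw [Real.one_le_sqrt]; linarith [Real.pi_gt_three]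
  have h2 : (√(2 * π * 1))⁻¹ ≤ 1 := inv_le_one_of_one_le₀ h1
  simp only [gaussianPDFReal, sub_zero, NNReal.coe_one]
  calc _ ≤ 1 * Real.exp (-z ^ 2 / (2 * 1)) := by gcongr
    _ = _ := by rw [one_mul]; congr 1; ring

lemma heatKernel_nonneg (h x b : ℝ) : 0 ≤ heatKernel h x b := by
  unfold heatKernel; positivity

lemma heatKernel_le {h : ℝ} (hh : 0 < h) (x b : ℝ) : heatKernel h x b ≤ (√h)⁻¹ := by
  rw [heatKernel_eq_inv_sqrt_mul hh]
  refine mul_le_of_le_one_right (by positivity) ((gaussianPDFReal_zero_one_le _).trans ?_)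
  exact Real.exp_le_one_iff.2 (by have := sq_nonneg ((b - x) / √h); linarith)

lemma abs_div_mul_heatKernel_le {h : ℝ} (hh : 0 < h) (x b : ℝ) :
    |(b - x) / h * heatKernel h x b| ≤ h⁻¹ := by
  have hs : 0 < √h := Real.sqrt_pos.2 hh
  set z := (b - x) / √h with hz
  have h1 : (b - x) / h * heatKernel h x b = h⁻¹ * (z * gaussianPDFReal 0 1 z) := by
    rw [heatKernel_eq_inv_sqrt_mul hh, ← hz, hz]; ring
  have h2 : |z| * gaussianPDFReal 0 1 z ≤ 1 := by
    have h3 : |z| ≤ Real.exp (z ^ 2 / 2) := by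
      have := Real.add_one_le_exp (z ^ 2 / 2)
      nlinarith [sq_nonneg (|z| - 1), sq_abs z]
    calc _ ≤ Real.exp (z ^ 2 / 2) * Real.exp (-(z ^ 2 / 2)) :=
          mul_le_mul h3 (gaussianPDFReal_zero_one_le z) (gaussianPDFReal_nonneg _ _ _)
            (Real.exp_nonneg _)
      _ = 1 := by rw [← Real.exp_add]; simp
  rw [h1, abs_mul, abs_of_pos (inv_pos.2 hh), abs_mul, abs_of_nonneg (gaussianPDFReal_nonneg 0 1 z)]
  exact mul_le_of_le_one_right (by positivity) h2

lemma hasDerivAt_heatKernel_left (h x b : ℝ) :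
    HasDerivAt (fun x => heatKernel h x b) ((b - x) / h * heatKernel h x b) x := by
  unfold heatKernel
  have h1 : HasDerivAt (fun x => -(x - b) ^ 2 / (2 * h)) (-(2 * (x - b)) / (2 * h)) x := by
    simpa using ((((hasDerivAt_id x).sub_const b).pow 2).neg.div_const (2 * h))
  have h2 := (h1.exp.const_mul (√(2 * π * h))⁻¹)
  refine h2.congr_deriv ?_
  rcases eq_or_ne h 0 with rfl | hne
  · simp
  · field_simp; ring

lemma continuous_heatKernel_left (h b : ℝ) : Continuous fun x => heatKernel h x b :=
  continuous_iff_continuousAt.2 fun x => (hasDerivAt_heatKernel_left h x b).continuousAt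

lemma hasDerivAt_setIntegral_Iic_heatKernel {h : ℝ} (hh : 0 < h) (x b : ℝ) :
    HasDerivAt (fun h => ∫ y in Iic b, heatKernel h x y)
      (-(1 / 2) * ((b - x) / h * heatKernel h x b)) h := by
  have hs : √h ≠ 0 := (Real.sqrt_pos.2 hh).ne'
  have h1 : HasDerivAt (fun h => (b - x) / √h) (-((b - x) * (1 / (2 * √h))) / √h ^ 2) h := by
    simpa [Pi.div_def] using (hasDerivAt_const h (b - x)).div (Real.hasDerivAt_sqrt hh.ne') hs
  have h2 := (hasDerivAt_setIntegral_Iic (continuous_gaussianPDFReal 0 1)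
    (integrable_gaussianPDFReal 0 1) ((b - x) / √h)).comp h h1
  refine HasDerivAt.congr_of_eventuallyEq (f₁ := fun h => ∫ y in Iic b, heatKernel h x y)
    (h2.congr_deriv ?_) ?_
  · rw [heatKernel_eq_inv_sqrt_mul hh, Real.sq_sqrt hh.le]
    field_simp
  · filter_upwards [lt_mem_nhds hh] with k hk
    exact setIntegral_Iic_heatKernel hk x b

lemma abs_setIntegral_Iic_heatKernel_le {h : ℝ} (hh : 0 < h) (x b : ℝ) :
    |∫ y in Iic b, heatKernel h x y| ≤ 1 := by
  have hv : h.toNNReal ≠ 0 := by simpa using hh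
  rw [abs_of_nonneg (setIntegral_nonneg measurableSet_Iic fun y _ => heatKernel_nonneg h x y)]
  simp only [heatKernel_eq_gaussianPDFReal hh.le]
  exact (setIntegral_le_integral (integrable_gaussianPDFReal x _)
    (Eventually.of_forall fun y => gaussianPDFReal_nonneg _ _ y)).trans_eq
    (integral_gaussianPDFReal_eq_one x hv)

lemma continuous_setIntegral_Iic_heatKernel {h : ℝ} (hh : 0 < h) (b : ℝ) :
    Continuous fun x => ∫ y in Iic b, heatKernel h x y := by
  simp only [setIntegral_Iic_heatKernel hh]
  have h1 : Continuous fun c => ∫ z in Iic c, gaussianPDFReal 0 1 z :=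
    continuous_iff_continuousAt.2 fun c => (hasDerivAt_setIntegral_Iic
      (continuous_gaussianPDFReal 0 1) (integrable_gaussianPDFReal 0 1) c).continuousAt
  exact h1.comp (by fun_prop)

lemma hasDerivAt_setIntegral_heatKernel_mul {u : ℝ → ℝ} (hu : Integrable u) {h : ℝ} (hh : 0 < h)
    (a b : ℝ) :
    HasDerivAt (fun h => ∫ x in Iic a, (∫ y in Iic b, heatKernel h x y) * u x)
      (-(1 / 2) * ∫ x in Iic a, (b - x) / h * heatKernel h x b * u x) h := by
  have hs : Ioi (h / 2) ∈ 𝓝 h := lt_mem_nhds (by linarith)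
  have hpos : ∀ k ∈ Ioi (h / 2), 0 < k := fun k hk => by
    rw [mem_Ioi] at hk; linarith
  rw [← integral_const_mul]
  refine (hasDerivAt_integral_of_dominated_loc_of_deriv_le (μ := volume.restrict (Iic a))
    (F := fun h x => (∫ y in Iic b, heatKernel h x y) * u x)
    (F' := fun h x => -(1 / 2) * ((b - x) / h * heatKernel h x b * u x))
    (bound := fun x => h⁻¹ * |u x|) hs ?_ ?_ ?_ ?_ ?_ ?_).2
  · filter_upwards [hs] with k hk
    exact (continuous_setIntegral_Iic_heatKernel (hpos k hk) b).aestronglyMeasurable.mul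
      hu.integrableOn.aestronglyMeasurable
  · exact hu.integrableOn.bdd_mul (c := 1)
      (continuous_setIntegral_Iic_heatKernel hh b).aestronglyMeasurable
      (Eventually.of_forall fun x => abs_setIntegral_Iic_heatKernel_le hh x b)
  · have hc := continuous_heatKernel_left h b
    exact ((((by fun_prop : Continuous fun x => (b - x) / h).mul hc).aestronglyMeasurable).mul
      hu.integrableOn.aestronglyMeasurable).const_mul _
  · refine Eventually.of_forall fun x k hk => ?_
    have hk0 := hpos k hk
    have h1 := abs_div_mul_heatKernel_le hk0 x b
    have h2 : k⁻¹ ≤ 2 * h⁻¹ := by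
      rw [mem_Ioi] at hk
      calc k⁻¹ ≤ (h / 2)⁻¹ := inv_anti₀ (by linarith) hk.le
        _ = _ := by rw [inv_div]; ring
    rw [Real.norm_eq_abs, abs_mul, abs_mul, abs_neg, abs_of_pos (by norm_num : (0 : ℝ) < 1 / 2)]
    nlinarith [abs_nonneg (u x)]
  · exact (hu.norm.const_mul _).integrableOn
  · refine Eventually.of_forall fun x k hk => ?_
    exact ((hasDerivAt_setIntegral_Iic_heatKernel (hpos k hk) x b).mul_const (u x)).congr_deriv
      (by ring)

lemma abs_setIntegral_heatKernel_deriv_sub_le {u u' : ℝ → ℝ} {K : ℝ} (hu : Integrable u)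
    (hu' : ∀ x, HasDerivAt u (u' x) x) (hu'c : Continuous u') (hK : ∀ x, |u' x| ≤ K)
    {h : ℝ} (hh : 0 < h) (a b : ℝ) :
    |(∫ x in Iic a, (b - x) / h * heatKernel h x b * u x) - heatKernel h a b * u a| ≤ K := by
  have hv : h.toNNReal ≠ 0 := by simpa using hh
  have huc : Continuous u := continuous_iff_continuousAt.2 fun x => (hu' x).continuousAt
  have hpc := continuous_heatKernel_left h b
  have hpi : Integrable fun x => heatKernel h x b := by
    simp only [heatKernel_comm h _ b, heatKernel_eq_gaussianPDFReal hh.le]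
    exact integrable_gaussianPDFReal b _
  have hp1 : ∫ x, heatKernel h x b = 1 := by
    simp only [heatKernel_comm h _ b, heatKernel_eq_gaussianPDFReal hh.le]
    exact integral_gaussianPDFReal_eq_one b hv
  have hd : ∀ x, HasDerivAt (fun x => heatKernel h x b * u x)
      ((b - x) / h * heatKernel h x b * u x + heatKernel h x b * u' x) x := fun x =>
    (hasDerivAt_heatKernel_left h x b).mul (hu' x)
  have hi1 : Integrable fun x => (b - x) / h * heatKernel h x b * u x :=
    hu.bdd_mul (c := h⁻¹) ((by fun_prop : Continuous fun x => (b - x) / h).mul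
      hpc).aestronglyMeasurable
      (Eventually.of_forall fun x => abs_div_mul_heatKernel_le hh x b)
  have hi2 : Integrable fun x => heatKernel h x b * u' x :=
    hpi.mul_bdd (c := K) hu'c.aestronglyMeasurable (Eventually.of_forall hK)
  have hi3 : Integrable fun x => heatKernel h x b * u x :=
    hu.bdd_mul (c := (√h)⁻¹) hpc.aestronglyMeasurable (Eventually.of_forall fun x => by
      rw [Real.norm_eq_abs, abs_of_nonneg (heatKernel_nonneg h x b)]
      exact heatKernel_le hh x b)
  have hFTC := integral_Iic_of_hasDerivAt_of_tendsto' (a := a) (fun x _ => hd x)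
    (hi1.add hi2).integrableOn
    (tendsto_zero_of_hasDerivAt_of_integrableOn_Iic (a := a) (fun x _ => hd x)
      (hi1.add hi2).integrableOn hi3.integrableOn)
  rw [integral_add hi1.integrableOn hi2.integrableOn, sub_zero] at hFTC
  have heq : (∫ x in Iic a, (b - x) / h * heatKernel h x b * u x) - heatKernel h a b * u a
      = -∫ x in Iic a, heatKernel h x b * u' x := by linarith
  have h0 : 0 ≤ K := (abs_nonneg _).trans (hK 0)
  rw [heq, abs_neg, ← Real.norm_eq_abs]
  calc _ ≤ ∫ x in Iic a, heatKernel h x b * K :=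
        norm_integral_le_of_norm_le (hpi.mul_const K).integrableOn
          (Eventually.of_forall fun x => by
            rw [Real.norm_eq_abs, abs_mul, abs_of_nonneg (heatKernel_nonneg h x b)]
            exact mul_le_mul_of_nonneg_left (hK x) (heatKernel_nonneg h x b))
    _ ≤ ∫ x, heatKernel h x b * K :=
        setIntegral_le_integral (hpi.mul_const K)
          (Eventually.of_forall fun x => mul_nonneg (heatKernel_nonneg h x b) h0)
    _ = K := by rw [integral_mul_const, hp1, one_mul]

/-- A Brownian motion with initial density `u`: the probability of being below `a` at time `0` and
below `b` at time `h` decreases in `h` at the rate `heatKernel h a b * u a / 2`, up to a bounded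
error. -/
lemma exists_setIntegral_heatKernel_mul_sub_eq {u u' : ℝ → ℝ} {K : ℝ} (hu : Integrable u)
    (hu' : ∀ x, HasDerivAt u (u' x) x) (hu'c : Continuous u') (hK : ∀ x, |u' x| ≤ K)
    {h k : ℝ} (hh : 0 < h) (hk : h < k) (a b : ℝ) :
    ∃ ξ ∈ Ioo h k, ∃ R : ℝ, |R| ≤ K ∧
      (∫ x in Iic a, (∫ y in Iic b, heatKernel k x y) * u x)
        - (∫ x in Iic a, (∫ y in Iic b, heatKernel h x y) * u x)
      = -(1 / 2) * (heatKernel ξ a b * u a + R) * (k - h) := by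
  have hd := fun (l : ℝ) (hl : 0 < l) => hasDerivAt_setIntegral_heatKernel_mul hu hl a b
  obtain ⟨ξ, hξ, hξ'⟩ := exists_hasDerivAt_eq_slope _ _ hk
    (fun l hl => (hd l (hh.trans_le hl.1)).continuousAt.continuousWithinAt)
    (fun l hl => hd l (hh.trans hl.1))
  refine ⟨ξ, hξ, _, abs_setIntegral_heatKernel_deriv_sub_le hu hu' hu'c hK (hh.trans hξ.1) a b, ?_⟩
  rw [eq_div_iff (sub_pos.2 hk).ne'] at hξ'
  rw [← hξ']
  ring

section Quantile

variable {U u : ℝ → ℝ → ℝ} {q : ℝ → ℝ} {α K₀ K₁ K₂ : ℝ}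

/-- Quantiles of a family of distribution functions `U · t` that is Lipschitz in `t` depend
continuously on `t`. -/
lemma continuousOn_quantile (hK₀ : 0 ≤ K₀) (hmono : ∀ t, 0 ≤ t → Monotone fun x => U x t)
    (hU : ∀ x s t, 0 ≤ s → 0 ≤ t → |U x t - U x s| ≤ K₀ * |t - s|)
    (hq : ∀ t, 0 ≤ t → U (q t) t = α) (hq' : ∀ t, 0 ≤ t → ∀ r, U r t = α → r = q t) :
    ContinuousOn q (Ici 0) := by
  rw [Metric.continuousOn_iff]
  intro s hs ε hε
  rw [mem_Ici] at hs
  have h1 : U (q s - ε) s < α := by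
    refine lt_of_le_of_ne ?_ fun h => ?_
    · rw [← hq s hs]; exact hmono s hs (by linarith)
    · linarith [hq' s hs _ h]
  have h2 : α < U (q s + ε) s := by
    refine lt_of_le_of_ne ?_ fun h => ?_
    · rw [← hq s hs]; exact hmono s hs (by linarith)
    · linarith [hq' s hs _ h.symm]
  set γ := min (α - U (q s - ε) s) (U (q s + ε) s - α)
  have hγ : 0 < γ := lt_min (by linarith) (by linarith)
  refine ⟨γ / (K₀ + 1), by positivity, fun t ht hts => ?_⟩
  rw [mem_Ici] at ht
  rw [Real.dist_eq, lt_div_iff₀ (by linarith)] at hts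
  have h3 : K₀ * |t - s| < γ := by nlinarith [abs_nonneg (t - s)]
  have h4 := h3.trans_le (min_le_left _ _)
  have h5 := h3.trans_le (min_le_right _ _)
  have h6 := abs_le.1 (hU (q s - ε) s t hs ht)
  have h7 := abs_le.1 (hU (q s + ε) s t hs ht)
  rw [Real.dist_eq, abs_lt]
  constructor
  · by_contra! hc
    have := hmono t ht (show q t ≤ q s - ε by linarith)
    simp only [hq t ht] at this
    linarith
  · by_contra! hc
    have := hmono t ht (show q s + ε ≤ q t by linarith)
    simp only [hq t ht] at this
    linarith

/-- If moreover the densities `u · t` are Lipschitz in both variables and positive at the quantile,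
then on compact time intervals they are bounded below there and the quantile is Lipschitz at small
scales. -/
lemma exists_quantile_bounds (hK₀ : 0 ≤ K₀) (hK₁ : 0 ≤ K₁)
    (hmono : ∀ t, 0 ≤ t → Monotone fun x => U x t)
    (hU : ∀ x s t, 0 ≤ s → 0 ≤ t → |U x t - U x s| ≤ K₀ * |t - s|)
    (hd : ∀ x t, 0 ≤ t → HasDerivAt (fun x => U x t) (u x t) x)
    (hux : ∀ x y t, 0 ≤ t → |u y t - u x t| ≤ K₁ * |y - x|)
    (hut : ∀ x s t, 0 ≤ s → 0 ≤ t → |u x t - u x s| ≤ K₂ * |t - s|)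
    (hq : ∀ t, 0 ≤ t → U (q t) t = α) (hq' : ∀ t, 0 ≤ t → ∀ r, U r t = α → r = q t)
    (hpos : ∀ t, 0 ≤ t → 0 < u (q t) t) {T : ℝ} (hT : 0 ≤ T) :
    ∃ m > 0, ∃ L ≥ 0, ∃ η > 0, (∀ t ∈ Icc 0 T, m ≤ u (q t) t) ∧
      ∀ s ∈ Icc 0 T, ∀ t ∈ Icc 0 T, |t - s| < η → |q t - q s| ≤ L * |t - s| := by
  have hqc : ContinuousOn q (Icc 0 T) :=
    (continuousOn_quantile hK₀ hmono hU hq hq').mono fun t ht => ht.1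
  have hvc : ContinuousOn (fun t => u (q t) t) (Icc 0 T) := by
    intro s hs
    rw [ContinuousWithinAt, tendsto_iff_dist_tendsto_zero]
    have h1 : Tendsto (fun t => K₁ * |q t - q s| + K₂ * |t - s|) (𝓝[Icc 0 T] s) (𝓝 0) := by
      have h2 : ContinuousWithinAt (fun t => K₁ * |q t - q s| + K₂ * |t - s|) (Icc 0 T) s :=
        (((hqc s hs).sub continuousWithinAt_const).abs.const_mul K₁).add
          ((continuousWithinAt_id.sub continuousWithinAt_const).abs.const_mul K₂)
      simpa [ContinuousWithinAt] using h2
    refine squeeze_zero' (Eventually.of_forall fun t => dist_nonneg) ?_ h1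
    filter_upwards [self_mem_nhdsWithin] with t ht
    rw [Real.dist_eq]
    calc _ = |(u (q t) t - u (q s) t) + (u (q s) t - u (q s) s)| := by congr 1; ring
      _ ≤ _ := (abs_add_le _ _).trans
        (add_le_add (hux _ _ t ht.1) (hut _ s t hs.1 ht.1))
  obtain ⟨t₀, ht₀, hmin⟩ := isCompact_Icc.exists_isMinOn (nonempty_Icc.2 hT) hvc
  set m := u (q t₀) t₀
  have hm : 0 < m := hpos t₀ ht₀.1
  have hmin' : ∀ t ∈ Icc 0 T, m ≤ u (q t) t := fun t ht => hmin ht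
  obtain ⟨η, hη, hη'⟩ := Metric.uniformContinuousOn_iff.1
    (isCompact_Icc.uniformContinuousOn_of_continuous hqc) (m / (2 * (K₁ + 1))) (by positivity)
  refine ⟨m, hm, 2 * K₀ / m, by positivity, η, hη, hmin', fun s hs t ht hst => ?_⟩
  have h1 := hη' t ht s hs hst
  rw [Real.dist_eq, lt_div_iff₀ (by positivity)] at h1
  have h2 : ∀ x ∈ uIcc (q s) (q t), m / 2 ≤ u x s := fun x hx => by
    have h3 := abs_le.1 (hux (q s) x s hs.1)
    have h4 : |x - q s| ≤ |q t - q s| := abs_sub_left_of_mem_uIcc hx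
    have h5 := hmin' s hs
    nlinarith [abs_nonneg (x - q s)]
  have h6 : m / 2 * |q t - q s| ≤ |U (q t) s - U (q s) s| := by
    rcases lt_trichotomy (q s) (q t) with hlt | heq | hlt
    · obtain ⟨ξ, hξ, hξ'⟩ := exists_hasDerivAt_eq_slope (fun x => U x s) (fun x => u x s) hlt
        (fun x _ => (hd x s hs.1).continuousAt.continuousWithinAt) (fun x _ => hd x s hs.1)
      have h7 := h2 ξ (Icc_subset_uIcc (Ioo_subset_Icc_self hξ))
      rw [eq_div_iff (sub_pos.2 hlt).ne'] at hξ'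
      rw [← hξ', abs_mul, abs_of_pos (a := u ξ s) (by linarith)]
      exact mul_le_mul_of_nonneg_right h7 (abs_nonneg _)
    · simp [heq]
    · obtain ⟨ξ, hξ, hξ'⟩ := exists_hasDerivAt_eq_slope (fun x => U x s) (fun x => u x s) hlt
        (fun x _ => (hd x s hs.1).continuousAt.continuousWithinAt) (fun x _ => hd x s hs.1)
      have h7 := h2 ξ (Icc_subset_uIcc' (Ioo_subset_Icc_self hξ))
      rw [eq_div_iff (sub_pos.2 hlt).ne'] at hξ'
      rw [abs_sub_comm (U (q t) s), ← hξ', abs_mul, abs_of_pos (a := u ξ s) (by linarith),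
        abs_sub_comm (q t)]
      exact mul_le_mul_of_nonneg_right h7 (abs_nonneg _)
  have h8 : U (q t) s - U (q s) s = -(U (q t) t - U (q t) s) := by
    rw [hq t ht.1, hq s hs.1]; ring
  rw [h8, abs_neg] at h6
  have h9 := h6.trans (hU (q t) s t hs.1 ht.1)
  rw [div_mul_eq_mul_div, le_div_iff₀ hm]
  linarith

end Quantile

lemma abs_measure_inter_sub_le {Ω : Type*} [MeasurableSpace Ω] (P : Measure Ω)
    [IsProbabilityMeasure P] (A : Set Ω) {Y : Ω → ℝ} (hY : Measurable Y) (b b' : ℝ) :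
    |(P {ω | ω ∈ A ∧ Y ω ≤ b'}).toReal - (P {ω | ω ∈ A ∧ Y ω ≤ b}).toReal|
      ≤ |(P {ω | Y ω ≤ b'}).toReal - (P {ω | Y ω ≤ b}).toReal| := by
  wlog hb : b ≤ b' generalizing b b'
  · rw [abs_sub_comm, abs_sub_comm (P {ω | Y ω ≤ b'}).toReal]
    exact this b' b (le_of_not_ge hb)
  change |P.real _ - P.real _| ≤ |P.real _ - P.real _|
  have hsub : {ω | Y ω ≤ b} ⊆ {ω | Y ω ≤ b'} := fun ω hω => le_trans hω hb
  have h1 : P.real {ω | ω ∈ A ∧ Y ω ≤ b} ≤ P.real {ω | ω ∈ A ∧ Y ω ≤ b'} :=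
    measureReal_mono fun ω hω => ⟨hω.1, hω.2.trans hb⟩
  have h2 := measureReal_sdiff (μ := P) hsub (hY measurableSet_Iic)
  have h3 : P.real {ω | ω ∈ A ∧ Y ω ≤ b'} ≤ P.real {ω | ω ∈ A ∧ Y ω ≤ b}
      + P.real ({ω | Y ω ≤ b'} \ {ω | Y ω ≤ b}) :=
    (measureReal_mono fun ω hω => by
      by_cases h : Y ω ≤ b
      · exact Or.inl ⟨hω.1, h⟩
      · exact Or.inr ⟨hω.2, h⟩).trans (measureReal_union_le _ _)
  rw [abs_of_nonneg (by linarith)]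
  exact le_trans (by linarith) (le_abs_self _)

lemma udens_pos {f : ℝ → ℝ} {C : ℝ} (hfc : Continuous f) (hf : ∀ x, 0 ≤ f x)
    (hC : ∀ x, |f x| ≤ C) {x₀ : ℝ} (hx₀ : 0 < f x₀) {t : ℝ} (ht : 0 < t) (x : ℝ) :
    0 < udens f x t := by
  rw [udens, if_neg ht.ne']
  have hp : ∀ y, 0 < heatKernel t x y := fun y => by
    unfold heatKernel; positivity
  have hpc : Continuous fun y => heatKernel t x y := by
    simpa only [heatKernel_comm t x] using continuous_heatKernel_left t x
  have hpi : Integrable fun y => heatKernel t x y := by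
    simp only [heatKernel_eq_gaussianPDFReal ht.le]
    exact integrable_gaussianPDFReal x _
  have hi : Integrable fun y => heatKernel t x y * f y :=
    hpi.mul_bdd (c := C) hfc.aestronglyMeasurable (Eventually.of_forall hC)
  rw [integral_pos_iff_support_of_nonneg (fun y => mul_nonneg (hp y).le (hf y)) hi]
  exact (hpc.mul hfc).isOpen_support.measure_pos volume
    ⟨x₀, (mul_pos (hp x₀) hx₀).ne'⟩

lemma le_heatKernel {h ξ a b L : ℝ} (hh : 0 < h) (hh1 : h ≤ 1) (hξ : h ≤ ξ)
    (hab : |b - a| ≤ L * h) :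
    (√(2 * π))⁻¹ * Real.exp (-(L ^ 2 / 2)) * (√ξ)⁻¹ ≤ heatKernel ξ a b := by
  have hξ0 : 0 < ξ := hh.trans_le hξ
  have h1 : (a - b) ^ 2 ≤ L ^ 2 * h ^ 2 := by
    rw [show (a - b) ^ 2 = |b - a| ^ 2 by rw [sq_abs]; ring, ← mul_pow]
    gcongr
  have h2 : -(L ^ 2 / 2) ≤ -(a - b) ^ 2 / (2 * ξ) := by
    rw [le_div_iff₀ (by positivity)]
    have h3 : h ^ 2 ≤ ξ := by nlinarith
    nlinarith [sq_nonneg L]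
  rw [heatKernel, Real.sqrt_mul (by positivity) ξ, mul_inv, mul_right_comm]
  gcongr

lemma rpow_neg_one_div_two {x : ℝ} (hx : 0 ≤ x) : x ^ (-(1 : ℝ) / 2) = (√x)⁻¹ := by
  rw [Real.sqrt_eq_rpow, ← Real.rpow_neg hx]
  norm_num

/-- Increment of a normalised covariance `A / (w * v)` in terms of the increments of `A` and `v`. -/
lemma abs_quotient_increment_add_le {A A' v v' w p d m E₀ Lv e : ℝ} (hd : 0 < d) (hm : 0 < m)
    (hw : m ≤ w) (hv : m ≤ v) (hv' : m ≤ v') (hA : |A| ≤ 1)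
    (hinc : A' - A = (-(1 / 2) * (p * w) + e) * d) (he : |e| ≤ E₀) (hvv : |v' - v| ≤ Lv * d) :
    |A' / (w * v') - A / (w * v) + p / (2 * v') * d| ≤ (E₀ / m ^ 2 + Lv / m ^ 3) * d := by
  have hw0 := hm.trans_le hw
  have hv0 := hm.trans_le hv
  have hv0' := hm.trans_le hv'
  have heq : A' / (w * v') - A / (w * v) + p / (2 * v') * d
      = e / (w * v') * d - A * (v' - v) / (w * v * v') := by
    rw [show A' = A + (-(1 / 2) * (p * w) + e) * d by linarith]
    field_simp
    ring
  have h1 : |e / (w * v') * d| ≤ E₀ / m ^ 2 * d := by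
    rw [abs_mul, abs_of_pos hd, abs_div, abs_of_pos (mul_pos hw0 hv0'), sq]
    have h0 : 0 ≤ E₀ := (abs_nonneg e).trans he
    gcongr
  have h2 : |A * (v' - v) / (w * v * v')| ≤ Lv / m ^ 3 * d := by
    rw [abs_div, abs_of_pos (mul_pos (mul_pos hw0 hv0) hv0'), abs_mul, div_mul_eq_mul_div,
      show m ^ 3 = m * m * m by ring]
    have h0 : 0 ≤ Lv * d := (abs_nonneg _).trans hvv
    have h3 : |A| * |v' - v| ≤ Lv * d := by nlinarith [abs_nonneg (v' - v), abs_nonneg A]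
    gcongr
  rw [heq, add_mul]
  exact (abs_sub _ _).trans (add_le_add h1 h2)

/-- Local anti-persistence of the increments:
`E[F(s)(F(t+Δt) − F(t))] = ρ(s,t+Δt) − ρ(s,t)` is negative of order `|t−s|^{-1/2}·Δt`. -/
theorem rho_increment_covariance_bound
    {Ω : Type*} [MeasurableSpace Ω] (P : Measure Ω) [IsProbabilityMeasure P]
    (f : SchwartzMap ℝ ℝ) (hf_nonneg : ∀ x, 0 ≤ f x) (hf_prob : ∫ x : ℝ, f x = 1)
    (α : ℝ) (hα : α ∈ Set.Ioo (0 : ℝ) 1)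
    (q : ℝ → ℝ)
    (hq : ∀ t, 0 ≤ t → ∫ x in Set.Iic (q t), udens (⇑f) x t = α)
    (hq_unique : ∀ t, 0 ≤ t → ∀ r : ℝ, (∫ x in Set.Iic r, udens (⇑f) x t = α) → r = q t)
    (hfq0 : 0 < f (q 0))
    (B : ℝ → Ω → ℝ) (hB_meas : ∀ t, Measurable (B t))
    (hBmarg : ∀ t, 0 ≤ t → ∀ a : ℝ,
      (P {ω | B t ω ≤ a}).toReal = ∫ x in Set.Iic a, udens (⇑f) x t)
    (hBjoint : ∀ s t : ℝ, 0 ≤ s → s < t → ∀ a b : ℝ,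
      (P {ω | B s ω ≤ a ∧ B t ω ≤ b}).toReal
        = ∫ x in Set.Iic a, (∫ y in Set.Iic b, heatKernel (t - s) x y) * udens (⇑f) x s)
    (T : ℝ) (hT : 0 < T) :
    ∃ δ > (0 : ℝ), ∃ C₁ > (0 : ℝ), ∃ C₂ > (0 : ℝ), ∀ s t Δt : ℝ,
      0 ≤ s → s < t → t ≤ T → 0 < Δt → t - s < δ → Δt < δ →
      -(C₂ * |t - s| ^ (-(1 : ℝ) / 2) * Δt)
          ≤ rho P B (⇑f) q α s (t + Δt) - rho P B (⇑f) q α s t ∧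
        rho P B (⇑f) q α s (t + Δt) - rho P B (⇑f) q α s t
          ≤ -(C₁ * |t + Δt - s| ^ (-(1 : ℝ) / 2) * Δt) := by
  obtain ⟨f', hf'⟩ : ∃ f' : SchwartzMap ℝ ℝ, ∀ x, HasDerivAt f (f' x) x :=
    ⟨SchwartzMap.derivCLM ℝ ℝ f, fun x => by
      rw [SchwartzMap.derivCLM_apply]; exact f.differentiableAt.hasDerivAt⟩
  obtain ⟨f'', hf''⟩ : ∃ f'' : SchwartzMap ℝ ℝ, ∀ x, HasDerivAt f' (f'' x) x :=
    ⟨SchwartzMap.derivCLM ℝ ℝ f', fun x => by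
      rw [SchwartzMap.derivCLM_apply]; exact f'.differentiableAt.hasDerivAt⟩
  obtain ⟨Ku, hKu⟩ : ∃ K, ∀ x, |f x| ≤ K := ⟨_, f.norm_le_seminorm ℝ⟩
  obtain ⟨K₁, hK₁⟩ : ∃ K, ∀ x, |f' x| ≤ K := ⟨_, f'.norm_le_seminorm ℝ⟩
  obtain ⟨K₂, hK₂⟩ : ∃ K, ∀ x, |f'' x| ≤ K := ⟨_, f''.norm_le_seminorm ℝ⟩
  have hK₁0 : 0 ≤ K₁ := (abs_nonneg _).trans (hK₁ 0)
  have hfi : Integrable f := f.integrable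
  set F : ℝ → ℝ := fun a => ∫ x in Iic a, f x
  have hF : ∀ x, HasDerivAt F (f x) x := hasDerivAt_setIntegral_Iic f.continuous hfi
  have hFC : ∀ x, |F x| ≤ 1 := fun x => by
    rw [abs_of_nonneg (setIntegral_nonneg measurableSet_Iic fun y _ => hf_nonneg y), ← hf_prob]
    exact setIntegral_le_integral hfi (Eventually.of_forall hf_nonneg)
  have hu : ∀ t, 0 ≤ t → (fun x => udens f x t) = fun x => gaussAvg f x t.toNNReal :=
    fun t ht => funext fun x => udens_eq_gaussAvg f x ht
  have hucdf : ∀ t, 0 ≤ t → ∀ r, ∫ x in Iic r, udens f x t = gaussAvg F r t.toNNReal :=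
    fun t ht r => by
      simp only [udens_eq_gaussAvg _ _ ht]
      exact setIntegral_Iic_gaussAvg f.continuous hfi _ r
  have hUd : ∀ x t, 0 ≤ t → HasDerivAt (fun x => gaussAvg F x t.toNNReal) (udens f x t) x :=
    fun x t ht => by
      rw [udens_eq_gaussAvg _ _ ht]
      exact hasDerivAt_gaussAvg hF f.continuous hFC hKu _ x
  have hunn : ∀ x t, 0 ≤ t → 0 ≤ udens f x t := fun x t ht => by
    rw [udens_eq_gaussAvg _ _ ht]
    exact integral_nonneg fun z => hf_nonneg _
  have hule : ∀ x t, 0 ≤ t → |udens f x t| ≤ Ku := fun x t ht => by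
    rw [udens_eq_gaussAvg _ _ ht]
    exact abs_gaussAvg_le hKu x _
  have hud : ∀ t, 0 ≤ t → ∀ x, HasDerivAt (fun x => udens f x t) (gaussAvg f' x t.toNNReal) x :=
    fun t ht x => by
      rw [hu t ht]
      exact hasDerivAt_gaussAvg hf' f'.continuous hKu hK₁ _ x
  have hudc : ∀ v, Continuous fun x => gaussAvg f' x v := fun v =>
    continuous_iff_continuousAt.2 fun x =>
      (hasDerivAt_gaussAvg hf'' f''.continuous hK₁ hK₂ v x).continuousAt
  have hut : ∀ x s t, 0 ≤ s → 0 ≤ t → |udens f x t - udens f x s| ≤ K₂ * |t - s| :=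
    fun x s t hs ht => by
      rw [udens_eq_gaussAvg _ _ ht, udens_eq_gaussAvg _ _ hs]
      exact abs_gaussAvg_sub_le hf' hf'' hKu hK₂ x hs ht
  have hux : ∀ x y t, 0 ≤ t → |udens f y t - udens f x t| ≤ K₁ * |y - x| := fun x y t ht =>
    abs_sub_le_of_hasDerivAt (hud t ht) (fun x => abs_gaussAvg_le hK₁ x _) x y
  have hpos : ∀ t, 0 ≤ t → 0 < udens f (q t) t := fun t ht => by
    rcases ht.eq_or_lt with rfl | ht
    · simpa [udens] using hfq0
    · exact udens_pos f.continuous hf_nonneg hKu hfq0 ht _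
  obtain ⟨m, hm, L, hL, η, hη, hmv, hLq⟩ := exists_quantile_bounds
    (U := fun x t => gaussAvg F x t.toNNReal) (u := udens f) (q := q) (α := α) (K₀ := K₁)
    (K₁ := K₁) (K₂ := K₂) hK₁0 hK₁0
    (fun t ht => monotone_of_hasDerivAt_nonneg (fun x => hUd x t ht) fun x => hunn x t ht)
    (fun x s t hs ht => abs_gaussAvg_sub_le hF hf' hFC hK₁ x hs ht)
    hUd hux hut
    (fun t ht => by rw [← hucdf t ht]; exact hq t ht)
    (fun t ht r hr => hq_unique t ht r (by rw [hucdf t ht]; exact hr))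
    hpos (T := T + 1) (by linarith)
  have hKu0 : 0 < Ku := (hpos 0 le_rfl).trans_le ((le_abs_self _).trans (hule _ 0 le_rfl))
  have hK₂0 : 0 ≤ K₂ := (abs_nonneg _).trans (hK₂ 0)
  set c := (√(2 * π))⁻¹ * Real.exp (-(L ^ 2 / 2))
  have hc : 0 < c := by positivity
  set E₁ := (K₁ / 2 + Ku * L) / m ^ 2 + (K₁ * L + K₂) / m ^ 3
  have hE₁ : 0 ≤ E₁ := by positivity
  set R := 4 * E₁ * Ku / c + 1
  have hR : 0 < R := by positivity
  refine ⟨min η (min 1 (1 / (2 * R ^ 2))), by positivity, c / (4 * Ku), by positivity,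
    1 / (2 * m) + E₁, by positivity, fun s t d hs hst htT hd hδ hdδ => ?_⟩
  rw [lt_min_iff, lt_min_iff] at hδ hdδ
  obtain ⟨hδη, hδ1, hδR⟩ := hδ
  obtain ⟨hdη, hd1, hdR⟩ := hdδ
  have ht : 0 ≤ t := hs.trans hst.le
  have htd : 0 ≤ t + d := by linarith
  have hsT : s ∈ Icc 0 (T + 1) := ⟨hs, by linarith⟩
  have htT' : t ∈ Icc 0 (T + 1) := ⟨ht, by linarith⟩
  have htdT : t + d ∈ Icc 0 (T + 1) := ⟨htd, by linarith⟩
  have hh : 0 < t - s := sub_pos.2 hst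
  have hqst : |q t - q s| ≤ L * (t - s) := by
    simpa [abs_of_pos hh] using hLq s hsT t htT' (by rwa [abs_of_pos hh])
  have hqtd : |q (t + d) - q t| ≤ L * d := by
    simpa [abs_of_pos hd] using hLq t htT' (t + d) htdT (by simpa [abs_of_pos hd] using hdη)
  have hvv : |udens f (q (t + d)) (t + d) - udens f (q t) t| ≤ (K₁ * L + K₂) * d := by
    have h1 := hux (q t) (q (t + d)) (t + d) htd
    have h2 := hut (q t) t (t + d) ht htd
    rw [add_sub_cancel_left, abs_of_pos hd] at h2
    have h3 : K₁ * |q (t + d) - q t| ≤ K₁ * (L * d) := mul_le_mul_of_nonneg_left hqtd hK₁0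
    have h4 := abs_sub_le (udens f (q (t + d)) (t + d)) (udens f (q t) (t + d)) (udens f (q t) t)
    linarith
  obtain ⟨ξ, hξ, r, hr, hξr⟩ := exists_setIntegral_heatKernel_mul_sub_eq
    (u := fun x => udens f x s) (by rw [hu s hs]; exact integrable_gaussAvg f.continuous hfi _)
    (hud s hs) (hudc _) (fun x => abs_gaussAvg_le hK₁ x _) hh
    (show t - s < t + d - s by linarith) (q s) (q t)
  rw [← hBjoint s t hs hst, ← hBjoint s (t + d) hs (by linarith),
    show t + d - s - (t - s) = d by ring] at hξr
  have hinc : |(P {ω | B s ω ≤ q s ∧ B (t + d) ω ≤ q (t + d)}).toReal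
      - (P {ω | B s ω ≤ q s ∧ B (t + d) ω ≤ q t}).toReal| ≤ Ku * L * d := by
    have h1 := abs_measure_inter_sub_le P {ω | B s ω ≤ q s} (hB_meas (t + d)) (q t) (q (t + d))
    rw [hBmarg _ htd, hBmarg _ htd, hucdf _ htd, hucdf _ htd] at h1
    refine h1.trans ((abs_sub_le_of_hasDerivAt (fun x => hUd x _ htd)
      (fun x => hule x _ htd) (q t) (q (t + d))).trans ?_)
    rw [mul_assoc]
    exact mul_le_mul_of_nonneg_left hqtd hKu0.le
  have hA : |(P {ω | B s ω ≤ q s ∧ B t ω ≤ q t}).toReal - α ^ 2| ≤ 1 := by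
    have h1 : (P {ω | B s ω ≤ q s ∧ B t ω ≤ q t}).toReal ≤ 1 := measureReal_le_one
    have h2 : 0 ≤ (P {ω | B s ω ≤ q s ∧ B t ω ≤ q t}).toReal := ENNReal.toReal_nonneg
    rw [abs_le]
    constructor <;> nlinarith [hα.1, hα.2]
  have hmain := abs_quotient_increment_add_le (p := heatKernel ξ (q s) (q t))
    (e := -(1 / 2) * r + ((P {ω | B s ω ≤ q s ∧ B (t + d) ω ≤ q (t + d)}).toReal
      - (P {ω | B s ω ≤ q s ∧ B (t + d) ω ≤ q t}).toReal) / d)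
    (A' := (P {ω | B s ω ≤ q s ∧ B (t + d) ω ≤ q (t + d)}).toReal - α ^ 2)
    (E₀ := K₁ / 2 + Ku * L)
    hd hm (hmv s hsT) (hmv t htT') (hmv (t + d) htdT) hA
    (by rw [add_mul, add_mul, div_mul_cancel₀ _ hd.ne']; linarith)
    (by
      refine (abs_add_le _ _).trans (add_le_add ?_ ?_)
      · rw [abs_mul, abs_neg, abs_of_pos (by norm_num : (0 : ℝ) < 1 / 2)]; linarith
      · rwa [abs_div, abs_of_pos hd, div_le_iff₀ hd])
    hvv
  change |rho P B f q α s (t + d) - rho P B f q α s t + _| ≤ E₁ * d at hmain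
  have hξ0 : 0 < ξ := hh.trans hξ.1
  have hp1 := le_heatKernel hh hδ1.le hξ.1.le hqst
  have hp2 := heatKernel_le hξ0 (q s) (q t)
  have hv1 := hmv (t + d) htdT
  have hv2 : udens f (q (t + d)) (t + d) ≤ Ku := (le_abs_self _).trans (hule _ _ htd)
  have hv0 := hpos (t + d) htd
  set p := heatKernel ξ (q s) (q t)
  set v := udens f (q (t + d)) (t + d)
  have hξh : (√ξ)⁻¹ ≤ (√(t - s))⁻¹ := inv_anti₀ (Real.sqrt_pos.2 hh) (Real.sqrt_le_sqrt hξ.1.le)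
  have hξd : (√(t + d - s))⁻¹ ≤ (√ξ)⁻¹ :=
    inv_anti₀ (Real.sqrt_pos.2 hξ0) (Real.sqrt_le_sqrt hξ.2.le)
  have hh1 : 1 ≤ (√(t - s))⁻¹ :=
    (one_le_inv₀ (Real.sqrt_pos.2 hh)).2 (Real.sqrt_le_one.2 hδ1.le)
  have hξR : R ≤ (√ξ)⁻¹ := by
    rw [le_inv_comm₀ hR (Real.sqrt_pos.2 hξ0), Real.sqrt_le_left (by positivity)]
    have h1 : 1 / (2 * R ^ 2) + 1 / (2 * R ^ 2) = R⁻¹ ^ 2 := by field_simp; norm_num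
    linarith [hξ.2]
  rw [abs_of_pos hh, abs_of_pos (by linarith : 0 < t + d - s), rpow_neg_one_div_two hh.le,
    rpow_neg_one_div_two (by linarith)]
  have hup : p / (2 * v) ≤ 1 / (2 * m) * (√(t - s))⁻¹ := by
    calc p / (2 * v) ≤ (√(t - s))⁻¹ / (2 * m) := by
          have : 0 ≤ (√(t - s))⁻¹ := by positivity
          gcongr
          exact hp2.trans hξh
      _ = _ := by ring
  have hlow : c / (4 * Ku) * (√ξ)⁻¹ + E₁ ≤ p / (2 * v) := by
    have h1 : c / (2 * Ku) * (√ξ)⁻¹ ≤ p / (2 * v) := by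
      calc _ = c * (√ξ)⁻¹ / (2 * Ku) := by ring
        _ ≤ _ := by
          have : 0 ≤ p := heatKernel_nonneg _ _ _
          gcongr
    have h2 : E₁ ≤ c / (4 * Ku) * (√ξ)⁻¹ := by
      calc E₁ = c / (4 * Ku) * (R - 1) := by simp only [R]; field_simp; ring
        _ ≤ _ := by
          gcongr
          linarith
    have h3 : c / (2 * Ku) * (√ξ)⁻¹ = c / (4 * Ku) * (√ξ)⁻¹ + c / (4 * Ku) * (√ξ)⁻¹ := by ring
    linarith
  have hm1 := abs_le.1 hmain
  constructor
  · have h1 : (p / (2 * v) + E₁) * d ≤ (1 / (2 * m) + E₁) * (√(t - s))⁻¹ * d := by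
      gcongr
      rw [add_mul]
      exact add_le_add hup (le_mul_of_one_le_right hE₁ hh1)
    linarith [hm1.1]
  · have h1 : c / (4 * Ku) * (√(t + d - s))⁻¹ * d ≤ (p / (2 * v) - E₁) * d := by
      gcongr
      have : c / (4 * Ku) * (√(t + d - s))⁻¹ ≤ c / (4 * Ku) * (√ξ)⁻¹ := by gcongr
      linarith
    linarith [hm1.2]
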